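/- arXiv:2409.01146 — 2 statements merged into one kernel-verified Lean document; each statement's English description precedes it below -/
import Mathlib

section
/- Let f̃ : Fin s → A and f : Fin k → A be families of Δ-homogeneous elements (f̃ j ∈ 𝒜 (d̃ j) and f j ∈ 𝒜 (d j) for weight functions d̃ : Fin s → Δ, d : Fin k → Δ), each generating A as a K-algebra (Algebra.adjoin K (Set.range f̃) = ⊤ and Algebra.adjoin K (Set.range f) = ⊤). Assume {f̃ 1,…,f̃ s} is a Δ-homogeneous MUVAK basis of A with respect to v_1,…,v_m, i.e. every g ∈ 𝒜 δ (for every δ ∈ Δ) is faithfully representable in f̃ with respect to v_1,…,v_m. If each f̃ j is faithfully representable in f with respect to v_1,…,v_m, then every g ∈ 𝒜 δ (for every δ ∈ Δ) is faithfully representable in f with respect to v_1,…,v_m; that is, {f 1,…,f k} is a Δ-homogeneous MUVAK basis of A with respect to v_1,…,v_m. -/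
open MvPolynomial

/-- `g` is faithfully representable in `f` with respect to the valuations `v 1, …, v m`:
there is a polynomial `h` with `aeval f h = g` such that for every term of `h` and every `i`
the evaluation of the term has `i`-th valuation at least `v i g`. -/
def FaithfullyRepresentable (K : Type*) {A : Type*} [Field K] [CommRing A] [Algebra K A]
    {m : ℕ} (v : Fin m → A → WithTop ℤ) {k : ℕ} (f : Fin k → A) (g : A) : Prop :=
  ∃ h : MvPolynomial (Fin k) K, MvPolynomial.aeval f h = g ∧
    ∀ a ∈ h.support, ∀ i : Fin m, v i g ≤ v i (∏ j, f j ^ (a j))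

theorem FaithfullyRepresentable.mul' {K A : Type*} [Field K] [CommRing A] [Algebra K A]
    {m : ℕ} {v : Fin m → A → WithTop ℤ}
    (hvmul : ∀ i, ∀ x y : A, v i (x * y) = v i x + v i y)
    {k : ℕ} {f : Fin k → A} {x y : A} (hx : FaithfullyRepresentable K v f x)
    (hy : FaithfullyRepresentable K v f y) : FaithfullyRepresentable K v f (x * y) := by
  classical
  obtain ⟨p, rfl, hp⟩ := hx
  obtain ⟨q, rfl, hq⟩ := hy
  refine ⟨p * q, map_mul _ _ _, fun a ha i => ?_⟩
  obtain ⟨b, hb, c, hc, rfl⟩ := Finset.mem_add.mp (MvPolynomial.support_mul p q ha)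
  simp only [Finsupp.add_apply, pow_add, Finset.prod_mul_distrib, hvmul]
  exact add_le_add (hp b hb i) (hq c hc i)

theorem FaithfullyRepresentable.one' {K A : Type*} [Field K] [CommRing A] [Algebra K A]
    {m : ℕ} {v : Fin m → A → WithTop ℤ} {k : ℕ} {f : Fin k → A} :
    FaithfullyRepresentable K v f 1 := by
  classical
  refine ⟨1, map_one _, fun a ha i => ?_⟩
  have : a = 0 := by
    by_contra h
    rw [MvPolynomial.mem_support_iff, MvPolynomial.coeff_one, if_neg (Ne.symm h)] at ha
    exact ha rfl
  simp [this]

/-- If `f̃` is a `Δ`-homogeneous MUVAK basis of `A` with respect to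
`v 1, …, v m` and each `f̃ j` is faithfully representable in the `Δ`-homogeneous generating
system `f`, then `f` is a `Δ`-homogeneous MUVAK basis as well. -/
theorem muvak_basis_transfer
    {K A Δ : Type*} [Field K] [CommRing A] [IsDomain A] [Algebra K A]
    [AddCommGroup Δ] [DecidableEq Δ]
    (𝒜 : Δ → Submodule K A) [GradedAlgebra 𝒜]
    {m : ℕ} (v : Fin m → A → WithTop ℤ)
    (hv0 : ∀ i, v i 0 = ⊤)
    (hvmul : ∀ i, ∀ x y : A, v i (x * y) = v i x + v i y)
    (hvadd : ∀ i, ∀ x y : A, min (v i x) (v i y) ≤ v i (x + y))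
    (hvK : ∀ i, ∀ c : K, c ≠ 0 → v i (algebraMap K A c) = 0)
    (hvfin : ∀ i, ∀ a : A, a ≠ 0 → v i a ≠ ⊤)
    {s k : ℕ} (dtilde : Fin s → Δ) (d : Fin k → Δ)
    (ftilde : Fin s → A) (f : Fin k → A)
    (hftilded : ∀ j, ftilde j ∈ 𝒜 (dtilde j)) (hfd : ∀ j, f j ∈ 𝒜 (d j))
    (hgentilde : Algebra.adjoin K (Set.range ftilde) = ⊤)
    (hgen : Algebra.adjoin K (Set.range f) = ⊤)
    (hmuvak : ∀ δ : Δ, ∀ g ∈ 𝒜 δ, FaithfullyRepresentable K v ftilde g)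
    (hrep : ∀ j : Fin s, FaithfullyRepresentable K v f (ftilde j)) :
    ∀ δ : Δ, ∀ g ∈ 𝒜 δ, FaithfullyRepresentable K v f g := by
  classical
  intro δ g hg
  obtain ⟨h, rfl, hh⟩ := hmuvak δ g hg
  have key : ∀ a : Fin s →₀ ℕ, FaithfullyRepresentable K v f (∏ j, ftilde j ^ (a j)) := by
    intro a
    refine Finset.prod_induction _ (FaithfullyRepresentable K v f)
      (fun _ _ => FaithfullyRepresentable.mul' hvmul) FaithfullyRepresentable.one' ?_
    intro j _
    induction a j with
    | zero => rw [pow_zero]; exact FaithfullyRepresentable.one'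
    | succ n ih => rw [pow_succ]; exact FaithfullyRepresentable.mul' hvmul ih (hrep j)
  choose P hP hPv using key
  refine ⟨∑ a ∈ h.support, h.coeff a • P a, ?_, ?_⟩
  · rw [map_sum, MvPolynomial.aeval_def ftilde h, MvPolynomial.eval₂_eq']
    refine Finset.sum_congr rfl fun a _ => ?_
    rw [map_smul, hP, Algebra.smul_def]
  · intro b hb i
    obtain ⟨a, ha, hb⟩ := Finset.mem_biUnion.mp (MvPolynomial.support_sum hb)
    exact (hh a ha i).trans (hPv a b (MvPolynomial.support_smul hb) i)
end

section
/- Let R := MvPolynomial (Option (Fin k)) K, with variables X_j at (some j) and t at none, graded by weighted degree with weights w : Option (Fin k) → ℤ satisfying 0 ≤ w (some j) for all j and w none = −1. Let J be an ideal of R that is homogeneous with respect to this grading (for every p ∈ J, every w-weighted homogeneous component of p lies in J). If u ∈ R is a polynomial in the variable t alone whose constant coefficient is nonzero (u is the image of some q : Polynomial K with q.coeff 0 ≠ 0 under the map sending Polynomial.X to the variable t), and u * p ∈ J for some p ∈ R, then p ∈ J. (Equivalently, J equals the contraction of its extension to the localization at S = {q ∈ K[t] : q(0) ≠ 0}: J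 = (S⁻¹J) ∩ R.) -/
open MvPolynomial

theorem comp_tpow_mul {K : Type*} [Field K] {σ : Type*} (w : σ → ℤ) (s : σ) (hs : w s = -1)
    (i : ℕ) (γ : ℤ) (p : MvPolynomial σ K) :
    weightedHomogeneousComponent w γ (X s ^ i * p)
      = X s ^ i * weightedHomogeneousComponent w (γ + i) p := by
  classical
  induction p using MvPolynomial.induction_on' with
  | add p q hp hq => rw [mul_add, map_add, hp, hq, map_add, mul_add]
  | monomial d a =>
    have h1 : IsWeightedHomogeneous w (monomial d a) (Finsupp.weight w d) :=
      isWeightedHomogeneous_monomial w d a rfl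
    have h2 : IsWeightedHomogeneous w (X s ^ i * monomial d a)
        (i • (-1 : ℤ) + Finsupp.weight w d) := by
      have h3 := (isWeightedHomogeneous_X K w s).pow i
      rw [hs] at h3
      exact h3.mul h1
    rw [weightedHomogeneousComponent_of_mem h1, weightedHomogeneousComponent_of_mem h2]
    simp only [nsmul_eq_mul]
    split_ifs with h4 h5 h5
    · rfl
    · exfalso; apply h5; linarith
    · exfalso; apply h4; linarith
    · simp

/-- Let `R = K[X_1, …, X_k, t]` (the variable `t` sitting at `none`) be
graded by weights `w` with `w (some j) ≥ 0` and `w none = -1`, and let `J` be a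
`w`-homogeneous ideal of `R`.  If `u` is a polynomial in `t` alone with nonzero constant
coefficient and `u * p ∈ J`, then `p ∈ J`; equivalently, `J` equals the contraction of its
extension to the localization at `S = {q ∈ K[t] : q(0) ≠ 0}`. -/
theorem homogeneous_ideal_eq_contraction_of_extension
    {K : Type*} [Field K] {k : ℕ}
    (w : Option (Fin k) → ℤ)
    (hw_nonneg : ∀ j : Fin k, 0 ≤ w (some j))
    (hw_t : w none = -1)
    (J : Ideal (MvPolynomial (Option (Fin k)) K))
    (hJ : ∀ p ∈ J, ∀ γ : ℤ, MvPolynomial.weightedHomogeneousComponent w γ p ∈ J)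
    (q : Polynomial K) (hq : q.coeff 0 ≠ 0)
    (u : MvPolynomial (Option (Fin k)) K)
    (hu : u = Polynomial.aeval (MvPolynomial.X none : MvPolynomial (Option (Fin k)) K) q)
    (p : MvPolynomial (Option (Fin k)) K)
    (hup : u * p ∈ J) :
    p ∈ J := by
  classical
  set c := fun γ : ℤ => weightedHomogeneousComponent w γ p with hc
  have hfin : (Function.support c).Finite := weightedHomogeneousComponent_finsupp p
  obtain ⟨B, hB⟩ := hfin.bddAbove
  have hstep : ∀ γ : ℤ, (∀ δ, γ < δ → c δ ∈ J) → c γ ∈ J := by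
    intro γ hγ
    have h := hJ _ hup γ
    rw [hu, Polynomial.aeval_eq_sum_range, Finset.sum_mul, map_sum,
      Finset.sum_range_succ'] at h
    simp only [smul_mul_assoc, map_smul, comp_tpow_mul w none hw_t] at h
    rw [Submodule.add_mem_iff_right] at h
    · have h' := Submodule.smul_of_tower_mem J (q.coeff 0)⁻¹ h
      rw [smul_smul, inv_mul_cancel₀ hq] at h'
      simpa [hc] using h'
    · refine Submodule.sum_mem _ fun i _ => ?_
      refine Submodule.smul_of_tower_mem J _ (J.mul_mem_left _ (hγ _ ?_))
      push_cast
      linarith [Int.natCast_nonneg i]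
  have hall : ∀ n : ℕ, ∀ γ : ℤ, B - n < γ → c γ ∈ J := by
    intro n
    induction n with
    | zero =>
      intro γ hγ
      by_cases h0 : c γ = 0
      · rw [h0]; exact J.zero_mem
      · have := hB (Function.mem_support.2 h0)
        simp at hγ
        linarith
    | succ n ih =>
      intro γ hγ
      refine hstep γ fun δ hδ => ih δ ?_
      push_cast at hγ
      omega
  rw [← sum_weightedHomogeneousComponent w p, finsum_eq_sum _ hfin]
  refine Submodule.sum_mem _ fun γ _ => hall (B - γ + 1).toNat γ ?_
  omega
end
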